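/- For every positive integer n with n ≡ 0 (mod 4), the bidirected complete graph K*_n admits a nomadic near-Hamiltonian decomposition: there exist nomads g_0, …, g_{n−1} : ℕ → ZMod n, each tracing a near-Hamiltonian cycle, such that every ordered pair (u,v) of distinct elements of ZMod n occurs exactly once among the pairs (g_i(t), g_i(t+1)) with 0 ≤ i ≤ n−1 and 0 ≤ t ≤ n−2, and such that g_i(t) ≠ g_j(t) whenever i ≠ j, for every t. -/

import Mathlib

open DihedralGroup

/-- A cyclic sequence of `k = |G| - 1` distinct elements of a group `G` whose successive quotients
`q` are distinct and nontrivial (an R-sequencing of `G`), spread around `G` by left translation. -/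
theorem exists_nomadic_of_rSequencing {G : Type*} [Group G] [Fintype G] {n k : ℕ} [NeZero n]
    (hk : n = k + 1) (hG : Fintype.card G = n) (f q : ℕ → G)
    (hf : Set.InjOn f (Set.Iio k)) (hq : Set.InjOn q (Set.Iio k)) (hq1 : ∀ t < k, q t ≠ 1)
    (hfq : ∀ t < k, f t * q t = f ((t + 1) % k)) :
    ∃ g : Fin n → ℕ → ZMod n,
      (∀ i, ∀ t, g i (t + k) = g i t) ∧
      (∀ i, ∀ t₁ t₂, t₁ < k → t₂ < k → g i t₁ = g i t₂ → t₁ = t₂) ∧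
      (∀ u v : ZMod n, u ≠ v →
        ∃! x : Fin n × Fin k, g x.1 (x.2 : ℕ) = u ∧ g x.1 ((x.2 : ℕ) + 1) = v) ∧
      (∀ i j : Fin n, i ≠ j → ∀ t, g i t ≠ g j t) := by
  classical
  have hq_surj : ∀ w : G, w ≠ 1 → ∃ t < k, q t = w := by
    have himage : (Finset.range k).image q = Finset.univ.erase 1 := by
      apply Finset.eq_of_subset_of_card_le
      · intro w hw
        obtain ⟨t, ht, rfl⟩ := Finset.mem_image.1 hw
        exact Finset.mem_erase.2 ⟨hq1 t (Finset.mem_range.1 ht), Finset.mem_univ _⟩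
      · rw [Finset.card_image_of_injOn (by simpa using hq), Finset.card_range,
          Finset.card_erase_of_mem (Finset.mem_univ _), Finset.card_univ]
        omega
    intro w hw
    have hmem : w ∈ (Finset.range k).image q := by simp [himage, hw]
    simpa using hmem
  let e : G ≃ ZMod n := Fintype.equivOfCardEq (by rw [hG, ZMod.card])
  let σ : Fin n ≃ G := Fintype.equivOfCardEq (by rw [hG, Fintype.card_fin])
  refine ⟨fun i t => e (σ i * f (t % k)), fun i t => by simp, ?_, ?_, ?_⟩
  · intro i t₁ t₂ h₁ h₂ h
    simp only [e.apply_eq_iff_eq, mul_right_inj, Nat.mod_eq_of_lt h₁, Nat.mod_eq_of_lt h₂] at h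
    exact hf h₁ h₂ h
  · intro u v huv
    have hiff : ∀ i, ∀ t : Fin k,
        (e (σ i * f ((t : ℕ) % k)) = u ∧ e (σ i * f (((t : ℕ) + 1) % k)) = v) ↔
          σ i = e.symm u * (f t)⁻¹ ∧ q t = (e.symm u)⁻¹ * e.symm v := by
      intro i t
      rw [Nat.mod_eq_of_lt t.2, ← hfq t t.2, ← Equiv.eq_symm_apply, ← Equiv.eq_symm_apply,
        ← mul_assoc, eq_mul_inv_iff_mul_eq, eq_inv_mul_iff_mul_eq]
      constructor
      · rintro ⟨h, h'⟩
        exact ⟨h, h ▸ h'⟩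
      · rintro ⟨h, h'⟩
        exact ⟨h, h.symm ▸ h'⟩
    simp only [hiff]
    obtain ⟨t, ht, hqt⟩ := hq_surj ((e.symm u)⁻¹ * e.symm v) fun h =>
      huv (e.symm.injective (inv_mul_eq_one.1 h))
    refine ⟨(σ.symm (e.symm u * (f t)⁻¹), ⟨t, ht⟩), ⟨by simp, hqt⟩, ?_⟩
    rintro ⟨i, s⟩ ⟨hi, hs⟩
    obtain rfl : t = s := hq ht s.2 (hqt.trans hs.symm)
    simp [← hi]
  · intro i j hij t h
    simp only [e.apply_eq_iff_eq, mul_left_inj, σ.apply_eq_iff_eq] at h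
    exact hij h

/-- An enumeration of the dihedral group of order `4 * m` by the natural numbers below `4 * m`:
first the rotations, then the reflections. -/
def dihedralOfNat (m c : ℕ) : DihedralGroup (2 * m) :=
  if c < 2 * m then r (c : ZMod (2 * m)) else sr (c : ZMod (2 * m))

theorem dihedralOfNat_injOn (m : ℕ) : Set.InjOn (dihedralOfNat m) (Set.Iio (4 * m)) := by
  intro x hx y hy h
  simp only [Set.mem_Iio] at hx hy
  unfold dihedralOfNat at h
  split_ifs at h with h₁ h₂ h₂
  · rw [r.injEq, ZMod.natCast_eq_natCast_iff] at h
    exact Nat.ModEq.eq_of_lt_of_lt h h₁ h₂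
  · rw [sr.injEq, ZMod.natCast_eq_natCast_iff'] at h
    rw [Nat.mod_eq_sub_mod (by omega), Nat.mod_eq_sub_mod (a := y) (by omega),
      Nat.mod_eq_of_lt (by omega), Nat.mod_eq_of_lt (by omega)] at h
    omega

theorem dihedralOfNat_mul_rotation {m x y z : ℕ} (hy : y < 2 * m) (hxz : x < 2 * m ↔ z < 2 * m)
    (h : x + y ≡ z [MOD 2 * m]) :
    dihedralOfNat m x * dihedralOfNat m y = dihedralOfNat m z := by
  have hc : (x : ZMod (2 * m)) + y = z := mod_cast (ZMod.natCast_eq_natCast_iff _ _ _).2 h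
  unfold dihedralOfNat
  by_cases hx : x < 2 * m
  · simp only [hx, hy, hxz.1 hx, if_true, r_mul_r, hc]
  · simp only [hx, hy, mt hxz.2 hx, if_true, if_false, sr_mul_r, hc]

theorem dihedralOfNat_mul_reflection {m x y z : ℕ} (hy : 2 * m ≤ y)
    (hxz : x < 2 * m ↔ 2 * m ≤ z) (h : x + z ≡ y [MOD 2 * m]) :
    dihedralOfNat m x * dihedralOfNat m y = dihedralOfNat m z := by
  have hc : (y : ZMod (2 * m)) - x = z := by
    have : (x : ZMod (2 * m)) + z = y := mod_cast (ZMod.natCast_eq_natCast_iff _ _ _).2 h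
    rw [← this, add_sub_cancel_left]
  unfold dihedralOfNat
  by_cases hx : x < 2 * m
  · simp only [hx, hy.not_gt, (hxz.1 hx).not_gt, if_true, if_false, r_mul_sr, hc]
  · simp only [hx, hy.not_gt, not_le.1 (mt hxz.2 hx), if_true, if_false, sr_mul_sr, hc]

/-- Codes of an R-sequencing of the dihedral group of order `4 * m`: a zigzag between rotations and
reflections, followed by a zigzag within the reflections and one within the rotations. -/
def dihedralVertex (m t : ℕ) : ℕ :=
  if t < 2 * m - 1 then
    if t % 2 = 0 then t / 2
    else if t / 2 < m / 2 then 2 * m + t / 2 else 2 * m + t / 2 + 1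
  else if t < 3 * m - 1 then
    if (t - (2 * m - 1)) % 2 = 0 then 3 * m + (t - (2 * m - 1)) / 2
    else 4 * m - 1 - (t - (2 * m - 1)) / 2
  else if (4 * m - 1 - t) % 2 = 0 then 2 * m - (4 * m - 1 - t) / 2
  else m + (4 * m - 1 - t) / 2

/-- Codes of the successive quotients of the R-sequencing `dihedralVertex`. -/
def dihedralStep (m t : ℕ) : ℕ :=
  if t < 2 * m - 1 then
    if t / 2 < m / 2 then 2 * m + t else 2 * m + t + 1
  else if t < 3 * m - 2 then
    if (t - (2 * m - 1)) % 2 = 0 then 3 * m - 2 - t else t + 2 - m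
  else if t = 3 * m - 2 then 2 * m + 2 * (m / 2)
  else if (4 * m - 1 - t) % 2 = 0 then 5 * m - 2 - t
  else t + 2 - 3 * m

theorem dihedralVertex_lt {m t : ℕ} (ht : t < 4 * m - 1) : dihedralVertex m t < 4 * m := by
  unfold dihedralVertex
  split_ifs <;> omega

theorem dihedralStep_lt {m t : ℕ} (ht : t < 4 * m - 1) : dihedralStep m t < 4 * m := by
  unfold dihedralStep
  split_ifs <;> omega

theorem dihedralStep_pos {m t : ℕ} (ht : t < 4 * m - 1) : 0 < dihedralStep m t := by
  unfold dihedralStep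
  split_ifs <;> omega

theorem dihedralVertex_injOn (m : ℕ) :
    Set.InjOn (dihedralVertex m) (Set.Iio (4 * m - 1)) := by
  intro s hs t ht h
  simp only [Set.mem_Iio] at hs ht
  unfold dihedralVertex at h
  split_ifs at h <;> omega

theorem dihedralStep_injOn (m : ℕ) :
    Set.InjOn (dihedralStep m) (Set.Iio (4 * m - 1)) := by
  intro s hs t ht h
  simp only [Set.mem_Iio] at hs ht
  unfold dihedralStep at h
  split_ifs at h <;> omega

set_option maxHeartbeats 2000000 in
theorem dihedralVertex_mul_dihedralStep {m t : ℕ} (ht : t < 4 * m - 1) :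
    dihedralOfNat m (dihedralVertex m t) * dihedralOfNat m (dihedralStep m t) =
      dihedralOfNat m (dihedralVertex m ((t + 1) % (4 * m - 1))) := by
  have hmod {a b : ℕ} (h : a = b ∨ a = b + 2 * m) : a ≡ b [MOD 2 * m] := by
    rcases h with rfl | rfl <;> simp [Nat.ModEq]
  have hnext : (t + 1) % (4 * m - 1) = if t + 1 = 4 * m - 1 then 0 else t + 1 := by
    split_ifs with h
    · rw [h, Nat.mod_self]
    · exact Nat.mod_eq_of_lt (by omega)
  rw [hnext]
  generalize hs : (if t + 1 = 4 * m - 1 then 0 else t + 1) = s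
  generalize hx : dihedralVertex m t = x
  generalize hy : dihedralStep m t = y
  generalize hz : dihedralVertex m s = z
  unfold dihedralVertex at hx hz
  unfold dihedralStep at hy
  have key : y < 2 * m ∧ (x < 2 * m ↔ z < 2 * m) ∧ (x + y = z ∨ x + y = z + 2 * m) ∨
      2 * m ≤ y ∧ (x < 2 * m ↔ 2 * m ≤ z) ∧ (x + z = y ∨ x + z = y + 2 * m) := by
    split_ifs at hy <;> split_ifs at hx <;>
      first
      | exfalso; omega
      | split_ifs at hs <;>
          first
          | exfalso; omega
          | split_ifs at hz <;> first | exfalso; omega | omega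
  rcases key with ⟨h, hxz, hsum⟩ | ⟨h, hxz, hsum⟩
  · exact dihedralOfNat_mul_rotation h hxz (hmod hsum)
  · exact dihedralOfNat_mul_reflection h hxz (hmod hsum)

/-- For every positive `n ≡ 0 (mod 4)`, the bidirected complete graph `K*_n` (vertex set
`ZMod n`) admits a nomadic near-Hamiltonian decomposition. -/
theorem nomadic_nearHam_decomposition_of_four_dvd (n : ℕ) (hn : 0 < n) (h4 : n % 4 = 0) :
    ∃ g : Fin n → ℕ → ZMod n,
      -- each nomad traces a near-Hamiltonian cycle: period n-1 …
      (∀ i, ∀ t, g i (t + (n - 1)) = g i t) ∧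
      -- … and injective on {0, …, n-2}
      (∀ i, ∀ t₁ t₂, t₁ < n - 1 → t₂ < n - 1 → g i t₁ = g i t₂ → t₁ = t₂) ∧
      -- every ordered pair of distinct vertices occurs exactly once as a consecutive pair
      (∀ u v : ZMod n, u ≠ v →
        ∃! x : Fin n × Fin (n - 1),
          g x.1 (x.2 : ℕ) = u ∧ g x.1 ((x.2 : ℕ) + 1) = v) ∧
      -- nomadic: distinct nomads never collide
      (∀ i j : Fin n, i ≠ j → ∀ t, g i t ≠ g j t) := by
  have : NeZero n := ⟨hn.ne'⟩
  obtain ⟨m, rfl⟩ : 4 ∣ n := Nat.dvd_of_mod_eq_zero h4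
  have : NeZero (2 * m) := ⟨by omega⟩
  have hone : dihedralOfNat m 0 = 1 := by
    simp [dihedralOfNat, show 0 < m by omega]
  refine exists_nomadic_of_rSequencing (G := DihedralGroup (2 * m)) (by omega)
    (by rw [DihedralGroup.card]; ring) (dihedralOfNat m ∘ dihedralVertex m)
    (dihedralOfNat m ∘ dihedralStep m)
    ((dihedralOfNat_injOn m).comp (dihedralVertex_injOn m) fun t ht => dihedralVertex_lt ht)
    ((dihedralOfNat_injOn m).comp (dihedralStep_injOn m) fun t ht => dihedralStep_lt ht)
    (fun t ht h => ?_) (fun t ht => dihedralVertex_mul_dihedralStep ht)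
  exact (dihedralStep_pos ht).ne'
    (dihedralOfNat_injOn m (dihedralStep_lt ht) (Set.mem_Iio.2 (by omega)) (h.trans hone.symm))
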